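/- arXiv:1504.04407 — 2 statements merged into one kernel-verified Lean document; each statement's English description precedes it below -/
import Mathlib

section
/- Fix points x, y ∈ ℝ^d and a mini-batch size b ∈ {1,…,n}. Let A be a subset of {1,…,n} of cardinality b chosen uniformly at random among all such subsets, and define G(A) = ∇F(x) + (1/b)∑_{i∈A}(∇f_i(y) − ∇f_i(x)). Then E[G(A)] = ∇F(y), and the variance satisfies E[‖G(A) − ∇F(y)‖²] ≤ 4·L·α(b)·( P(y) − P(x*) + P(x) − P(x*) ), where α(b) = (n−b)/(b(n−1)). -/
open Finset

section Sampling

variable {ι : Type*} [Fintype ι] [DecidableEq ι]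

theorem card_filter_mem_powersetCard_univ {b : ℕ} (hb : 1 ≤ b) (i : ι) :
    #{A ∈ powersetCard b (univ : Finset ι) | i ∈ A} =
      (Fintype.card ι - 1).choose (b - 1) := by
  simpa [singleton_subset_iff] using
    card_filter_powersetCard_subset {i} (univ : Finset ι) b (subset_univ _) (by simpa)

/-- The number of `b`-element sets containing two given points, times `card ι - 1`. -/
theorem card_sub_one_mul_card_filter_mem_and_mem {b : ℕ} (hb : 1 ≤ b) (i j : ι) :
    ((Fintype.card ι : ℝ) - 1) * #{A ∈ powersetCard b (univ : Finset ι) | i ∈ A ∧ j ∈ A} =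
      (Fintype.card ι - 1).choose (b - 1) *
        (((b : ℝ) - 1) + if i = j then (Fintype.card ι : ℝ) - b else 0) := by
  by_cases hij : i = j
  · subst hij
    simp only [and_self, card_filter_mem_powersetCard_univ hb, if_true]
    ring
  simp only [hij, if_false, add_zero]
  obtain rfl | hb2 := hb.eq_or_lt
  · have : ({A ∈ powersetCard 1 (univ : Finset ι) | i ∈ A ∧ j ∈ A} : Finset _) = ∅ := by
      refine filter_eq_empty_iff.2 fun A hA h => hij ?_
      exact card_le_one.1 (mem_powersetCard.1 hA).2.le i h.1 j h.2
    simp [this]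
  have hcard : #{A ∈ powersetCard b (univ : Finset ι) | i ∈ A ∧ j ∈ A} =
      (Fintype.card ι - 2).choose (b - 2) := by
    simpa [insert_subset_iff, card_pair hij] using
      card_filter_powersetCard_subset {i, j} (univ : Finset ι) b (subset_univ _)
        (by rw [card_pair hij]; exact hb2)
  have hn : 2 ≤ Fintype.card ι := by
    rw [← card_pair hij]; exact card_le_univ _
  rw [hcard]
  obtain ⟨m, hm⟩ := Nat.exists_eq_add_of_le' hn
  obtain ⟨k, rfl⟩ := Nat.exists_eq_add_of_le' hb2
  rw [hm]
  have h := Nat.add_one_mul_choose_eq m k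
  have h' : ((m : ℝ) + 1) * m.choose k = (m + 1).choose (k + 1) * (k + 1) := by exact_mod_cast h
  simp only [Nat.add_sub_cancel, show m + 2 - 1 = m + 1 by lia, Nat.succ_eq_add_one,
    show k + (1 + 1) - 1 = k + 1 by lia, show k + (1 + 1) - 2 = k by lia]
  push_cast
  linear_combination h'

theorem sum_powersetCard_univ_sum {M : Type*} [AddCommMonoid M] {b : ℕ} (hb : 1 ≤ b)
    (v : ι → M) :
    ∑ A ∈ powersetCard b (univ : Finset ι), ∑ i ∈ A, v i =
      (Fintype.card ι - 1).choose (b - 1) • ∑ i, v i := by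
  have h : ∀ A : Finset ι, ∑ i ∈ A, v i = ∑ i, if i ∈ A then v i else 0 := by simp
  rw [sum_congr rfl fun A _ => h A, sum_comm, smul_sum]
  refine sum_congr rfl fun i _ => ?_
  rw [← sum_filter, sum_const, card_filter_mem_powersetCard_univ hb]

theorem card_mul_choose_pred {n b : ℕ} (hb : 1 ≤ b) (hbn : b ≤ n) :
    (n : ℝ) * (n - 1).choose (b - 1) = b * n.choose b := by
  obtain ⟨k, rfl⟩ := Nat.exists_eq_add_of_le' hb
  obtain ⟨m, rfl⟩ := Nat.exists_eq_add_of_le' (hb.trans hbn)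
  have h := Nat.add_one_mul_choose_eq m k
  simp only [Nat.add_sub_cancel]
  rw [mul_comm ((k + 1 : ℕ) : ℝ)]
  exact_mod_cast h

variable {E : Type*} [NormedAddCommGroup E] [InnerProductSpace ℝ E]

/-- Second moment of the sum of a centred family over the `b`-element subsets. -/
theorem card_sub_one_mul_sum_powersetCard_norm_sq {b : ℕ} (hb : 1 ≤ b) (w : ι → E)
    (hw : ∑ i, w i = 0) :
    ((Fintype.card ι : ℝ) - 1) *
        ∑ A ∈ powersetCard b (univ : Finset ι), ‖∑ i ∈ A, w i‖ ^ 2 =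
      (Fintype.card ι - 1).choose (b - 1) * ((Fintype.card ι : ℝ) - b) * ∑ i, ‖w i‖ ^ 2 := by
  have h : ∀ A : Finset ι, ‖∑ i ∈ A, w i‖ ^ 2 =
      ∑ i, ∑ j, if i ∈ A ∧ j ∈ A then inner ℝ (w i) (w j) else 0 := by
    intro A
    rw [← real_inner_self_eq_norm_sq, sum_inner]
    simp_rw [inner_sum, ite_and]
    rw [← sum_subset (subset_univ A) (by intro i _ hi; simp [hi])]
    exact sum_congr rfl fun i hi => by simp [hi]
  have h0 : ∑ i, ∑ j, inner ℝ (w i) (w j) = 0 := by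
    simp_rw [← inner_sum, hw, inner_zero_right, sum_const_zero]
  simp_rw [h]
  rw [sum_comm]
  simp_rw [sum_comm (s := powersetCard b (univ : Finset ι)), ← sum_filter, sum_const,
    nsmul_eq_mul, mul_sum, ← mul_assoc, card_sub_one_mul_card_filter_mem_and_mem hb,
    mul_add, add_mul, sum_add_distrib, ← mul_sum, h0]
  simp [mul_sum]

/-- Variance of the mean of a uniformly random `b`-element sample drawn without replacement. -/
theorem sum_powersetCard_norm_sample_mean_sub_sq_le {b : ℕ} (hb : 1 ≤ b)
    (hbn : b ≤ Fintype.card ι) (hn : 2 ≤ Fintype.card ι) (v : ι → E) :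
    (#(powersetCard b (univ : Finset ι)) : ℝ)⁻¹ *
        ∑ A ∈ powersetCard b (univ : Finset ι),
          ‖(b : ℝ)⁻¹ • ∑ i ∈ A, v i - (Fintype.card ι : ℝ)⁻¹ • ∑ i, v i‖ ^ 2 ≤
      ((Fintype.card ι : ℝ) - b) / (b * ((Fintype.card ι : ℝ) - 1)) *
        ((Fintype.card ι : ℝ)⁻¹ * ∑ i, ‖v i‖ ^ 2) := by
  set n := Fintype.card ι with hn_def
  have hb0 : (0 : ℝ) < b := by exact_mod_cast hb
  have hn1 : (0 : ℝ) < (n : ℝ) - 1 := by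
    have : (2 : ℝ) ≤ n := by exact_mod_cast hn
    linarith
  have hn0 : (0 : ℝ) < n := by linarith
  have hbn' : (b : ℝ) ≤ n := by exact_mod_cast hbn
  set m : E := (n : ℝ)⁻¹ • ∑ i, v i with hm
  have hnm : (n : ℝ) • m = ∑ i, v i := smul_inv_smul₀ hn0.ne' _
  have hw : ∑ i, (v i - m) = 0 := by
    rw [sum_sub_distrib, sum_const, card_univ, ← hn_def, ← Nat.cast_smul_eq_nsmul ℝ, hnm,
      sub_self]
  have hdev : ∀ A ∈ powersetCard b (univ : Finset ι),
      ‖(b : ℝ)⁻¹ • ∑ i ∈ A, v i - m‖ ^ 2 = ((b : ℝ)⁻¹) ^ 2 * ‖∑ i ∈ A, (v i - m)‖ ^ 2 := by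
    intro A hA
    rw [sum_sub_distrib, sum_const, (mem_powersetCard.1 hA).2, ← Nat.cast_smul_eq_nsmul ℝ,
      ← mul_pow, ← abs_of_pos (inv_pos.2 hb0), ← Real.norm_eq_abs, ← norm_smul, Real.norm_eq_abs,
      abs_of_pos (inv_pos.2 hb0), smul_sub, inv_smul_smul₀ hb0.ne']
  have hcentre : ∑ i, ‖v i - m‖ ^ 2 ≤ ∑ i, ‖v i‖ ^ 2 := by
    have h : ∑ i, ‖v i - m‖ ^ 2 = ∑ i, ‖v i‖ ^ 2 - n * ‖m‖ ^ 2 := by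
      simp_rw [norm_sub_sq_real, sum_add_distrib, sum_sub_distrib, ← mul_sum, ← sum_inner, ← hnm,
        real_inner_smul_left, real_inner_self_eq_norm_sq, sum_const, card_univ, ← hn_def,
        nsmul_eq_mul]
      ring
    rw [h]
    have : 0 ≤ n * ‖m‖ ^ 2 := by positivity
    linarith
  have hN : (0 : ℝ) < n.choose b := by exact_mod_cast Nat.choose_pos hbn
  have hsum := card_sub_one_mul_sum_powersetCard_norm_sq hb _ hw
  rw [← hn_def] at hsum
  have hc := card_mul_choose_pred hb hbn
  rw [sum_congr rfl hdev, ← mul_sum, card_powersetCard, card_univ, ← hn_def]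
  set S := ∑ A ∈ powersetCard b (univ : Finset ι), ‖∑ i ∈ A, (v i - m)‖ ^ 2
  set c : ℝ := (((n - 1).choose (b - 1) : ℕ) : ℝ)
  have hS : (n.choose b : ℝ)⁻¹ * (((b : ℝ)⁻¹) ^ 2 * S) =
      ((n : ℝ) - b) / (b * ((n : ℝ) - 1)) * ((n : ℝ)⁻¹ * ∑ i, ‖v i - m‖ ^ 2) := by
    field_simp
    refine mul_left_cancel₀ hn0.ne' ?_
    linear_combination (n : ℝ) ^ 2 * hsum +
      n * ((n : ℝ) - b) * (∑ i, ‖v i - m‖ ^ 2) * hc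
  rw [hS]
  have : 0 ≤ (n : ℝ) - b := by linarith
  gcongr

end Sampling

section Gradient

variable {E : Type*} [NormedAddCommGroup E] [InnerProductSpace ℝ E] [CompleteSpace E]

theorem HasGradientAt.hasDerivAt_comp_add_smul {f : E → ℝ} {g x h : E} {t : ℝ}
    (hf : HasGradientAt f g (x + t • h)) :
    HasDerivAt (fun s : ℝ => f (x + s • h)) (inner ℝ g h) t := by
  have hl : HasDerivAt (fun s : ℝ => x + s • h) h t := by
    simpa using ((hasDerivAt_id t).smul_const h).const_add x
  exact hf.hasFDerivAt.comp_hasDerivAt t hl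

/-- First-order characterization of convexity. -/
theorem ConvexOn.add_inner_gradient_le {f : E → ℝ} (hf : ConvexOn ℝ Set.univ f) {g x : E}
    (hg : HasGradientAt f g x) (y : E) : f x + inner ℝ g (y - x) ≤ f y := by
  have hφ : ConvexOn ℝ Set.univ (fun s : ℝ => f (x + s • (y - x))) := by
    have := hf.comp_affineMap (AffineMap.lineMap x y : ℝ →ᵃ[ℝ] E)
    simpa [Function.comp_def, AffineMap.lineMap_apply, add_comm] using this
  have hd : HasDerivAt (fun s : ℝ => f (x + s • (y - x))) (inner ℝ g (y - x)) 0 :=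
    HasGradientAt.hasDerivAt_comp_add_smul (by simpa using hg)
  have := hφ.le_slope_of_hasDerivAt (Set.mem_univ _) (Set.mem_univ _) zero_lt_one hd
  simp [slope_def_field] at this
  linarith

/-- The descent lemma for functions with Lipschitz gradient. -/
theorem le_add_inner_gradient_add_of_lipschitz {f : E → ℝ} {f' : E → E} {L : ℝ}
    (hg : ∀ x, HasGradientAt f (f' x) x) (hlip : ∀ x y, ‖f' x - f' y‖ ≤ L * ‖x - y‖) (x y : E) :
    f y ≤ f x + inner ℝ (f' x) (y - x) + L / 2 * ‖y - x‖ ^ 2 := by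
  set h := y - x with hh
  have hd : ∀ t : ℝ, HasDerivAt
      (fun s : ℝ => f (x + s • h) - s * inner ℝ (f' x) h - L / 2 * ‖h‖ ^ 2 * s ^ 2)
      (inner ℝ (f' (x + t • h)) h - inner ℝ (f' x) h - L * ‖h‖ ^ 2 * t) t := by
    intro t
    have h1 := (hg (x + t • h)).hasDerivAt_comp_add_smul
    have h2 := (hasDerivAt_id t).mul_const (inner ℝ (f' x) h)
    have h3 := ((hasDerivAt_id t).pow 2).const_mul (L / 2 * ‖h‖ ^ 2)
    refine ((h1.sub h2).sub h3).congr_deriv ?_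
    simp only [Nat.cast_ofNat, id_eq]
    ring
  have hanti := antitoneOn_of_deriv_nonpos (convex_Ici (0 : ℝ))
    (fun t _ => (hd t).continuousAt.continuousWithinAt)
    (fun t _ => (hd t).differentiableAt.differentiableWithinAt) (by
      intro t ht
      rw [interior_Ici] at ht
      have ht : 0 < t := ht
      rw [(hd t).deriv, ← inner_sub_left]
      have h1 := real_inner_le_norm (f' (x + t • h) - f' x) h
      have h2 := hlip (x + t • h) x
      rw [add_sub_cancel_left, norm_smul, Real.norm_eq_abs, abs_of_pos ht] at h2
      have h3 := mul_le_mul_of_nonneg_right h2 (norm_nonneg h)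
      linarith)
  have := hanti (Set.mem_Ici.2 le_rfl) (Set.mem_Ici.2 zero_le_one) zero_le_one
  simp [hh] at this
  rw [hh]
  linarith

/-- Co-coercivity: the Bregman divergence of a smooth convex function controls the
gradient difference. -/
theorem ConvexOn.norm_gradient_sub_sq_le {f : E → ℝ} {f' : E → E} {L : ℝ} (hL : 0 < L)
    (hf : ConvexOn ℝ Set.univ f) (hg : ∀ x, HasGradientAt f (f' x) x)
    (hlip : ∀ x y, ‖f' x - f' y‖ ≤ L * ‖x - y‖) (y z : E) :
    ‖f' y - f' z‖ ^ 2 ≤ 2 * L * (f y - f z - inner ℝ (f' z) (y - z)) := by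
  set r := f' y - f' z with hr
  have h1 := hf.add_inner_gradient_le (hg z) (y - L⁻¹ • r)
  have h2 := le_add_inner_gradient_add_of_lipschitz hg hlip y (y - L⁻¹ • r)
  have h3 : inner ℝ (f' y) r - inner ℝ (f' z) r = ‖r‖ ^ 2 := by
    rw [← inner_sub_left, real_inner_self_eq_norm_sq]
  rw [show y - L⁻¹ • r - z = (y - z) - L⁻¹ • r by abel, inner_sub_right,
    real_inner_smul_right] at h1
  rw [sub_sub_cancel_left, inner_neg_right, real_inner_smul_right, norm_neg, norm_smul,
    Real.norm_eq_abs, abs_of_pos (inv_pos.2 hL)] at h2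
  have h4 : ‖r‖ ^ 2 / (2 * L) ≤ f y - f z - inner ℝ (f' z) (y - z) := by
    have : ‖r‖ ^ 2 / (2 * L) = L⁻¹ * ‖r‖ ^ 2 - L / 2 * (L⁻¹ * ‖r‖) ^ 2 := by
      field_simp
      ring
    rw [this]
    linear_combination h1 + h2 - L⁻¹ * h3
  rwa [div_le_iff₀' (by positivity)] at h4

/-- Optimality condition for a composite objective: the negative gradient of the smooth part is a
subgradient of the convex part at a minimizer. -/
theorem ConvexOn.neg_inner_gradient_le_of_isMinOn_add {F R : E → ℝ} {g z : E}
    (hR : ConvexOn ℝ Set.univ R) (hg : HasGradientAt F g z)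
    (hmin : ∀ x, F z + R z ≤ F x + R x) (y : E) : -inner ℝ g (y - z) ≤ R y - R z := by
  have hd : HasDerivAt (fun s : ℝ => F (z + s • (y - z))) (inner ℝ g (y - z)) 0 :=
    HasGradientAt.hasDerivAt_comp_add_smul (by simpa using hg)
  have hlim := hd.tendsto_slope_zero_right
  rw [neg_le]
  refine ge_of_tendsto hlim ?_
  have hlt : ∀ᶠ t : ℝ in nhdsWithin 0 (Set.Ioi 0), t < 1 :=
    nhdsWithin_le_nhds (gt_mem_nhds zero_lt_one)
  filter_upwards [hlt, self_mem_nhdsWithin] with t ht1 ht0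
  have ht0 : 0 < t := ht0
  have hc := hR.2 (Set.mem_univ z) (Set.mem_univ y) (sub_nonneg.2 ht1.le) ht0.le (by ring)
  rw [show (1 - t) • z + t • y = z + t • (y - z) by module, smul_eq_mul, smul_eq_mul] at hc
  have := hmin (z + t • (y - z))
  simp only [zero_add, zero_smul, add_zero, smul_eq_mul]
  rw [inv_mul_eq_div, le_div_iff₀ ht0]
  linarith

end Gradient


/-- Theorem 4 (bounding the variance of the mini-batch stochastic gradient estimate).
With `G(A) = ∇F(x) + (1/b) ∑_{i∈A} (∇f_i(y) − ∇f_i(x))` for a uniformly random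
`b`-element subset `A` of `{1,…,n}`:
`E[G(A)] = ∇F(y)` and
`E[‖G(A) − ∇F(y)‖²] ≤ 4·L·α(b)·(P(y) − P(x*) + P(x) − P(x*))`,
where `α(b) = (n−b)/(b(n−1))`. -/
theorem minibatch_variance_bound (d n : ℕ) (hd : 1 ≤ d) (hn : 2 ≤ n)
    (f : Fin n → EuclideanSpace ℝ (Fin d) → ℝ)
    (f' : Fin n → EuclideanSpace ℝ (Fin d) → EuclideanSpace ℝ (Fin d))
    (L : ℝ) (hL : 0 < L)
    (hconv : ∀ i, ConvexOn ℝ Set.univ (f i))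
    (hgrad : ∀ i x, HasGradientAt (f i) (f' i x) x)
    (hlip : ∀ i x y, ‖f' i x - f' i y‖ ≤ L * ‖x - y‖)
    (F : EuclideanSpace ℝ (Fin d) → ℝ) (hF : ∀ x, F x = (n : ℝ)⁻¹ * ∑ i, f i x)
    (R : EuclideanSpace ℝ (Fin d) → ℝ) (hRconv : ConvexOn ℝ Set.univ R)
    (hRcont : Continuous R)
    (P : EuclideanSpace ℝ (Fin d) → ℝ) (hP : ∀ x, P x = F x + R x)
    (μ : ℝ) (hμ : 0 < μ)
    (hstrong : ConvexOn ℝ Set.univ (fun x => P x - μ / 2 * ‖x‖ ^ 2))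
    (xstar : EuclideanSpace ℝ (Fin d)) (hxstar : ∀ x, P xstar ≤ P x)
    (x y : EuclideanSpace ℝ (Fin d))
    (b : ℕ) (hb1 : 1 ≤ b) (hbn : b ≤ n)
    (G : Finset (Fin n) → EuclideanSpace ℝ (Fin d))
    (hG : ∀ A, G A = ((n : ℝ)⁻¹ • ∑ i, f' i x)
        + (b : ℝ)⁻¹ • ∑ i ∈ A, (f' i y - f' i x))
    (gradFy : EuclideanSpace ℝ (Fin d)) (hgradFy : gradFy = (n : ℝ)⁻¹ • ∑ i, f' i y) :
    ((((Finset.powersetCard b (Finset.univ : Finset (Fin n))).card : ℝ))⁻¹ •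
        ∑ A ∈ Finset.powersetCard b (Finset.univ : Finset (Fin n)), G A) = gradFy ∧
    (((Finset.powersetCard b (Finset.univ : Finset (Fin n))).card : ℝ))⁻¹ *
        ∑ A ∈ Finset.powersetCard b (Finset.univ : Finset (Fin n)), ‖G A - gradFy‖ ^ 2
      ≤ 4 * L * (((n : ℝ) - (b : ℝ)) / ((b : ℝ) * ((n : ℝ) - 1))) *
          ((P y - P xstar) + (P x - P xstar)) := by
  have hn0 : (0 : ℝ) < n := by positivity
  have hb0 : (0 : ℝ) < b := by positivity
  have hdev : ∀ A, G A - gradFy = (b : ℝ)⁻¹ • ∑ i ∈ A, (f' i y - f' i x) -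
      (n : ℝ)⁻¹ • ∑ i, (f' i y - f' i x) := by
    intro A
    rw [hG, hgradFy, sum_sub_distrib (s := univ), smul_sub]
    abel
  have hN : (0 : ℝ) < n.choose b := by exact_mod_cast Nat.choose_pos hbn
  constructor
  · have hc := card_mul_choose_pred hb1 hbn
    have hcoef : (n.choose b : ℝ)⁻¹ * (b : ℝ)⁻¹ * ((n - 1).choose (b - 1) : ℕ) =
        (n : ℝ)⁻¹ := by
      field_simp
      linear_combination hc
    simp_rw [hG]
    rw [sum_add_distrib, sum_const, ← smul_sum, sum_powersetCard_univ_sum hb1, card_powersetCard,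
      card_univ, Fintype.card_fin, smul_add, ← Nat.cast_smul_eq_nsmul ℝ (n.choose b),
      inv_smul_smul₀ hN.ne', ← Nat.cast_smul_eq_nsmul ℝ, smul_smul, smul_smul, hcoef, hgradFy,
      sum_sub_distrib, smul_sub]
    abel
  have hgradF : HasGradientAt F ((n : ℝ)⁻¹ • ∑ i, f' i xstar) xstar := by
    have h := (HasFDerivAt.fun_sum fun i (_ : i ∈ univ) =>
      (hgrad i xstar).hasFDerivAt).const_mul (n : ℝ)⁻¹
    rw [hasGradientAt_iff_hasFDerivAt]
    simpa [funext hF, map_sum] using h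
  have hgap : ∀ z, (n : ℝ)⁻¹ * ∑ i, ‖f' i z - f' i xstar‖ ^ 2 ≤ 2 * L * (P z - P xstar) := by
    intro z
    have hsub := hRconv.neg_inner_gradient_le_of_isMinOn_add hgradF
      (fun x => by rw [← hP, ← hP]; exact hxstar x) z
    have hco : (n : ℝ)⁻¹ * ∑ i, ‖f' i z - f' i xstar‖ ^ 2 ≤
        (n : ℝ)⁻¹ * ∑ i, 2 * L * (f i z - f i xstar - inner ℝ (f' i xstar) (z - xstar)) := by
      gcongr with i
      exact (hconv i).norm_gradient_sub_sq_le hL (hgrad i) (hlip i) z xstar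
    refine hco.trans ?_
    rw [← mul_sum, sum_sub_distrib, sum_sub_distrib, ← sum_inner, mul_left_comm]
    rw [real_inner_smul_left] at hsub
    gcongr
    rw [hP, hP, hF, hF]
    linarith
  have hvar := sum_powersetCard_norm_sample_mean_sub_sq_le hb1 (by simpa using hbn)
    (by simpa using hn) fun i => f' i y - f' i x
  simp only [Fintype.card_fin] at hvar
  simp_rw [hdev]
  have hsplit : (n : ℝ)⁻¹ * ∑ i, ‖f' i y - f' i x‖ ^ 2 ≤
      4 * L * ((P y - P xstar) + (P x - P xstar)) := by
    have h : ∑ i, ‖f' i y - f' i x‖ ^ 2 ≤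
        2 * (∑ i, ‖f' i y - f' i xstar‖ ^ 2 + ∑ i, ‖f' i x - f' i xstar‖ ^ 2) := by
      rw [← sum_add_distrib, mul_sum]
      gcongr with i
      rw [← sub_sub_sub_cancel_right (f' i y) (f' i x) (f' i xstar)]
      have := parallelogram_law_with_norm ℝ (f' i y - f' i xstar) (f' i x - f' i xstar)
      nlinarith [sq_nonneg ‖f' i y - f' i xstar + (f' i x - f' i xstar)‖]
    have h' := mul_le_mul_of_nonneg_left h (inv_nonneg.2 hn0.le)
    linarith [hgap x, hgap y]
  have hα : 0 ≤ ((n : ℝ) - b) / (b * ((n : ℝ) - 1)) := by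
    have h1 : (b : ℝ) ≤ n := by exact_mod_cast hbn
    have h2 : (2 : ℝ) ≤ n := by exact_mod_cast hn
    exact div_nonneg (by linarith) (mul_nonneg hb0.le (by linarith))
  linarith [mul_le_mul_of_nonneg_left hsplit hα]
end

section
/- Fix points x, y ∈ ℝ^d, a mini-batch size b ∈ {1,…,n}, and a stepsize h with 0 < h ≤ 1/L. Let A be a subset of {1,…,n} of cardinality b chosen uniformly at random, let G(A) = ∇F(x) + (1/b)∑_{i∈A}(∇f_i(y) − ∇f_i(x)), and let y⁺(A) = prox_{hR}(y − h·G(A)). Then E[‖y⁺(A) − x*‖²] + 2h·E[P(y⁺(A)) − P(x*)] ≤ ‖y − x*‖² + 8·L·h²·α(b)·( P(y) − P(x*) + P(x) − P(x*) ), where α(b) = (n−b)/(b(n−1)). -/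
open Finset
open scoped RealInnerProductSpace

section Smooth

variable {E : Type*} [NormedAddCommGroup E] [InnerProductSpace ℝ E]

section Gradient

variable [CompleteSpace E]

lemma HasGradientAt.hasDerivAt_line {f : E → ℝ} {g x v : E} {t : ℝ}
    (hf : HasGradientAt f g (x + t • v)) :
    HasDerivAt (fun s : ℝ => f (x + s • v)) ⟪g, v⟫ t := by
  have hline : HasDerivAt (fun s : ℝ => x + s • v) v t := by
    simpa using ((hasDerivAt_id t).smul_const v).const_add x
  have := hf.hasFDerivAt.comp_hasDerivAt t hline
  rw [InnerProductSpace.toDual_apply_apply] at this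
  exact this

lemma ConvexOn.add_inner_le_of_hasGradientAt {f : E → ℝ} {g x : E}
    (hf : ConvexOn ℝ Set.univ f) (hg : HasGradientAt f g x) (y : E) :
    f x + ⟪g, y - x⟫ ≤ f y := by
  have hc : ConvexOn ℝ Set.univ (fun t : ℝ => f (x + t • (y - x))) := by
    refine ⟨convex_univ, fun s _ t _ a b ha hb hab => ?_⟩
    have := hf.2 (Set.mem_univ (x + s • (y - x))) (Set.mem_univ (x + t • (y - x))) ha hb hab
    refine le_of_eq_of_le (congrArg f ?_) this
    obtain rfl : a = 1 - b := by linarith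
    simp only [smul_eq_mul]
    module
  have hd : HasDerivAt (fun t : ℝ => f (x + t • (y - x))) ⟪g, y - x⟫ 0 :=
    HasGradientAt.hasDerivAt_line (by simpa using hg)
  have := hc.le_slope_of_hasDerivAt (Set.mem_univ 0) (Set.mem_univ 1) one_pos hd
  simp [slope_def_field] at this
  linarith

lemma le_add_inner_add_sq_of_lipschitz_gradient {f : E → ℝ} {f' : E → E} {L : ℝ}
    (hgrad : ∀ x, HasGradientAt f (f' x) x) (hlip : ∀ x y, ‖f' x - f' y‖ ≤ L * ‖x - y‖)
    (x y : E) : f y ≤ f x + ⟪f' x, y - x⟫ + L / 2 * ‖y - x‖ ^ 2 := by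
  set v := y - x with hv
  let ψ : ℝ → ℝ := fun t => f (x + t • v) - t * ⟪f' x, v⟫ - L / 2 * ‖v‖ ^ 2 * t ^ 2
  have hψ (t : ℝ) : HasDerivAt ψ
      (⟪f' (x + t • v), v⟫ - 1 * ⟪f' x, v⟫ - L / 2 * ‖v‖ ^ 2 * (2 * t)) t := by
    refine (HasDerivAt.sub (hgrad _).hasDerivAt_line ((hasDerivAt_id t).mul_const _)).sub ?_
    simpa using (hasDerivAt_pow 2 t).const_mul (L / 2 * ‖v‖ ^ 2)
  have hanti : AntitoneOn ψ (Set.Icc 0 1) := by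
    refine antitoneOn_of_deriv_nonpos (convex_Icc 0 1)
      (fun t _ => (hψ t).continuousAt.continuousWithinAt)
      (fun t _ => (hψ t).differentiableAt.differentiableWithinAt) fun t ht => ?_
    rw [interior_Icc] at ht
    rw [(hψ t).deriv]
    have h1 : ⟪f' (x + t • v) - f' x, v⟫ ≤ ‖f' (x + t • v) - f' x‖ * ‖v‖ := real_inner_le_norm _ _
    have h2 : ‖f' (x + t • v) - f' x‖ ≤ L * (t * ‖v‖) := by
      simpa [norm_smul, abs_of_pos ht.1] using hlip (x + t • v) x
    have h3 := mul_le_mul_of_nonneg_right h2 (norm_nonneg v)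
    rw [inner_sub_left] at h1
    nlinarith
  have := hanti (Set.left_mem_Icc.2 zero_le_one) (Set.right_mem_Icc.2 zero_le_one) zero_le_one
  simp only [ψ, hv] at this
  simp at this
  linarith

lemma ConvexOn.sq_norm_gradient_sub_le {f : E → ℝ} {f' : E → E} {L : ℝ} (hL : 0 < L)
    (hf : ConvexOn ℝ Set.univ f) (hgrad : ∀ x, HasGradientAt f (f' x) x)
    (hlip : ∀ x y, ‖f' x - f' y‖ ≤ L * ‖x - y‖) (x y : E) :
    ‖f' x - f' y‖ ^ 2 ≤ 2 * L * (f x - f y - ⟪f' y, x - y⟫) := by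
  set w := f' x - f' y with hw
  have h1 := hf.add_inner_le_of_hasGradientAt (hgrad y) (x - L⁻¹ • w)
  have h2 := le_add_inner_add_sq_of_lipschitz_gradient hgrad hlip x (x - L⁻¹ • w)
  have h3 : ⟪f' x, w⟫ - ⟪f' y, w⟫ = ‖w‖ ^ 2 := by
    rw [← inner_sub_left, ← hw, real_inner_self_eq_norm_sq]
  have e1 : ⟪f' y, x - L⁻¹ • w - y⟫ = ⟪f' y, x - y⟫ - L⁻¹ * ⟪f' y, w⟫ := by
    rw [sub_right_comm, inner_sub_right, real_inner_smul_right]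
  have e2 : ⟪f' x, x - L⁻¹ • w - x⟫ = - (L⁻¹ * ⟪f' x, w⟫) := by
    rw [sub_right_comm, sub_self, zero_sub, inner_neg_right, real_inner_smul_right]
  have e3 : L / 2 * ‖x - L⁻¹ • w - x‖ ^ 2 = L⁻¹ / 2 * ‖w‖ ^ 2 := by
    rw [sub_right_comm, sub_self, zero_sub, norm_neg, norm_smul, Real.norm_eq_abs, mul_pow, sq_abs]
    field_simp
  rw [e1] at h1
  rw [e2, e3] at h2
  have h4 : L⁻¹ * ‖w‖ ^ 2 ≤ 2 * (f x - f y - ⟪f' y, x - y⟫) := by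
    rw [← h3] at h2 ⊢
    nlinarith
  calc ‖w‖ ^ 2 = L * (L⁻¹ * ‖w‖ ^ 2) := by field_simp
    _ ≤ L * (2 * (f x - f y - ⟪f' y, x - y⟫)) := by gcongr
    _ = _ := by ring

end Gradient

lemma nonneg_of_forall_add_mul_nonneg {a c : ℝ} (h : ∀ t : ℝ, 0 < t → t ≤ 1 → 0 ≤ a + t * c) :
    0 ≤ a := by
  have hlim : Filter.Tendsto (fun t : ℝ => a + t * c) (nhdsWithin 0 (Set.Ioi 0)) (nhds a) := by
    have : Continuous fun t : ℝ => a + t * c := by fun_prop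
    simpa using (this.tendsto 0).mono_left nhdsWithin_le_nhds
  refine ge_of_tendsto hlim ?_
  filter_upwards [Ioc_mem_nhdsGT (zero_lt_one (α := ℝ))] with t ht using h t ht.1 ht.2

/-- First-order optimality condition for the sum of a convex function and a function that is
bounded above by a quadratic tangent to it at the minimizer. -/
lemma ConvexOn.inner_add_sub_nonneg_of_minimizer {φ R : E → ℝ} {p g : E} {c : ℝ}
    (hR : ConvexOn ℝ Set.univ R) (hφ : ∀ z, φ z ≤ φ p + ⟪g, z - p⟫ + c * ‖z - p‖ ^ 2)
    (hmin : ∀ z, φ p + R p ≤ φ z + R z) (z : E) : 0 ≤ ⟪g, z - p⟫ + (R z - R p) := by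
  refine nonneg_of_forall_add_mul_nonneg (c := c * ‖z - p‖ ^ 2) fun t ht0 ht1 => ?_
  have h1 := hmin (p + t • (z - p))
  have h2 := hφ (p + t • (z - p))
  have h3 : R (p + t • (z - p)) ≤ (1 - t) * R p + t * R z := by
    have := hR.2 (Set.mem_univ p) (Set.mem_univ z) (sub_nonneg.2 ht1) ht0.le (by ring)
    refine le_of_eq_of_le (congrArg R ?_) this
    module
  rw [add_sub_cancel_left, real_inner_smul_right, norm_smul, Real.norm_eq_abs, mul_pow,
    sq_abs] at h2
  refine nonneg_of_mul_nonneg_right (a := t) ?_ ht0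
  nlinarith

/-- Variational inequality characterizing a proximal point `p` of `w`. -/
lemma ConvexOn.inner_sub_le_of_prox {R : E → ℝ} (hR : ConvexOn ℝ Set.univ R) {h : ℝ}
    (hh : 0 ≤ h) {w p : E}
    (hp : ∀ z, (1 / 2) * ‖p - w‖ ^ 2 + h * R p ≤ (1 / 2) * ‖z - w‖ ^ 2 + h * R z) (z : E) :
    ⟪w - p, z - p⟫ ≤ h * (R z - R p) := by
  have := (hR.smul hh).inner_add_sub_nonneg_of_minimizer (φ := fun z => (1 / 2) * ‖z - w‖ ^ 2)
    (g := p - w) (c := 1 / 2) (fun z => ?_) hp z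
  · rw [← neg_sub, inner_neg_left] at this
    simp only [smul_eq_mul] at this
    linarith
  · have e : z - w = (p - w) + (z - p) := by abel
    simp only [e, norm_add_sq_real]
    linarith

/-- The proximal map is firmly nonexpansive, in the form used for two perturbed gradient steps. -/
lemma ConvexOn.inner_sub_le_of_prox_of_prox {R : E → ℝ} (hR : ConvexOn ℝ Set.univ R) {h : ℝ}
    (hh : 0 < h) {y g₁ g₂ p₁ p₂ : E}
    (h₁ : ∀ z, (1 / 2) * ‖p₁ - (y - h • g₁)‖ ^ 2 + h * R p₁
      ≤ (1 / 2) * ‖z - (y - h • g₁)‖ ^ 2 + h * R z)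
    (h₂ : ∀ z, (1 / 2) * ‖p₂ - (y - h • g₂)‖ ^ 2 + h * R p₂
      ≤ (1 / 2) * ‖z - (y - h • g₂)‖ ^ 2 + h * R z) :
    ⟪g₁ - g₂, p₂ - p₁⟫ ≤ h * ‖g₁ - g₂‖ ^ 2 := by
  have a := hR.inner_sub_le_of_prox hh.le h₁ p₂
  have b := hR.inner_sub_le_of_prox hh.le h₂ p₁
  have key : ‖p₂ - p₁‖ ^ 2 ≤ h * ⟪g₁ - g₂, p₂ - p₁⟫ := by
    have e : ⟪y - h • g₁ - p₁, p₂ - p₁⟫ + ⟪y - h • g₂ - p₂, p₁ - p₂⟫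
        = ‖p₂ - p₁‖ ^ 2 - h * ⟪g₁ - g₂, p₂ - p₁⟫ := by
      rw [← neg_sub p₂ p₁, inner_neg_right, ← sub_eq_add_neg, ← inner_sub_left,
        ← real_inner_self_eq_norm_sq, ← real_inner_smul_left, ← inner_sub_left]
      congr 1
      module
    linarith
  have hc := real_inner_le_norm (g₁ - g₂) (p₂ - p₁)
  have hle : ‖p₂ - p₁‖ ≤ h * ‖g₁ - g₂‖ := by
    by_contra! hlt
    nlinarith [norm_nonneg (g₁ - g₂), mul_le_mul_of_nonneg_left hc hh.le,
      mul_nonneg hh.le (norm_nonneg (g₁ - g₂))]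
  nlinarith [norm_nonneg (g₁ - g₂)]

/-- If `∑ δ = 0` and differences of `p` are controlled by differences of `δ`, then the
correlation of `δ` with `-p` is at most `h ∑ ‖δ‖²`. -/
lemma sum_neg_inner_le_of_pairwise {α : Type*} (S : Finset α) {δ p : α → E} {h : ℝ}
    (h0 : ∑ A ∈ S, δ A = 0)
    (hpair : ∀ A ∈ S, ∀ B ∈ S, ⟪δ A - δ B, p B - p A⟫ ≤ h * ‖δ A - δ B‖ ^ 2) :
    -∑ A ∈ S, ⟪δ A, p A⟫ ≤ h * ∑ A ∈ S, ‖δ A‖ ^ 2 := by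
  rcases S.eq_empty_or_nonempty with rfl | hS
  · simp
  have hcard : (0 : ℝ) < #S := by exact_mod_cast hS.card_pos
  have hsum := sum_le_sum fun A hA => sum_le_sum fun B hB => hpair A hA B hB
  have e1 : ∑ A ∈ S, ∑ B ∈ S, ⟪δ A - δ B, p B - p A⟫ = -2 * #S * ∑ A ∈ S, ⟪δ A, p A⟫ := by
    simp only [inner_sub_left, inner_sub_right, sum_sub_distrib, sum_const, ← inner_sum,
      ← sum_inner, h0, inner_zero_left, nsmul_eq_mul, ← mul_sum]
    ring
  have e2 : ∑ A ∈ S, ∑ B ∈ S, h * ‖δ A - δ B‖ ^ 2 = h * (2 * #S * ∑ A ∈ S, ‖δ A‖ ^ 2) := by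
    simp only [← mul_sum, norm_sub_sq_real, sum_add_distrib, sum_sub_distrib, sum_const,
      ← inner_sum, ← sum_inner, h0, inner_zero_left, nsmul_eq_mul]
    ring
  rw [e1, e2] at hsum
  refine le_of_mul_le_mul_left ?_ (mul_pos two_pos hcard)
  linarith

/-- Deterministic descent for one inexact proximal gradient step with gradient `g + δ`. -/
lemma ConvexOn.prox_grad_step {F R : E → ℝ} (hR : ConvexOn ℝ Set.univ R) {h L : ℝ} (hh : 0 < h)
    (hL : h * L ≤ 1) {y g δ p u : E}
    (hp : ∀ z, (1 / 2) * ‖p - (y - h • (g + δ))‖ ^ 2 + h * R p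
      ≤ (1 / 2) * ‖z - (y - h • (g + δ))‖ ^ 2 + h * R z)
    (htan : F y + ⟪g, u - y⟫ ≤ F u)
    (hdesc : F p ≤ F y + ⟪g, p - y⟫ + L / 2 * ‖p - y‖ ^ 2) :
    ‖p - u‖ ^ 2 + 2 * h * ((F p + R p) - (F u + R u))
      ≤ ‖y - u‖ ^ 2 + 2 * h * (⟪δ, u⟫ - ⟪δ, p⟫) := by
  have hv := hR.inner_sub_le_of_prox hh.le hp u
  have e1 : ⟪y - h • (g + δ) - p, u - p⟫
      = ⟪y - p, u - p⟫ - h * (⟪g, u - y⟫ - ⟪g, p - y⟫) - h * (⟪δ, u⟫ - ⟪δ, p⟫) := by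
    rw [← inner_sub_right, ← inner_sub_right, sub_sub_sub_cancel_right,
      show y - h • (g + δ) - p = (y - p) - h • g - h • δ by module, inner_sub_left, inner_sub_left,
      real_inner_smul_left, real_inner_smul_left]
  have e2 : ‖y - u‖ ^ 2 = ‖p - y‖ ^ 2 - 2 * ⟪y - p, u - p⟫ + ‖p - u‖ ^ 2 := by
    rw [← sub_sub_sub_cancel_right y u p, norm_sub_sq_real, norm_sub_rev y p, norm_sub_rev u p]
  have h1 := mul_le_mul_of_nonneg_left (add_le_add htan hdesc) hh.le
  have h2 := mul_le_mul_of_nonneg_right hL (sq_nonneg ‖p - y‖)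
  rw [e1] at hv
  nlinarith

lemma sum_sq_norm_sub_mean_le {ι : Type*} [Fintype ι] {v : ι → E} {m : E}
    (hm : ∑ i, v i = (Fintype.card ι : ℝ) • m) :
    ∑ i, ‖v i - m‖ ^ 2 ≤ ∑ i, ‖v i‖ ^ 2 := by
  simp only [norm_sub_sq_real, sum_add_distrib, sum_sub_distrib, ← mul_sum, ← sum_inner, hm,
    real_inner_smul_left, real_inner_self_eq_norm_sq, sum_const, card_univ, nsmul_eq_mul]
  nlinarith [mul_nonneg (Nat.cast_nonneg (α := ℝ) (Fintype.card ι)) (sq_nonneg ‖m‖)]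

end Smooth

section Sampling

variable {ι : Type*} [Fintype ι] [DecidableEq ι]

lemma card_filter_mem_powersetCard_mul {b : ℕ} (hb : 1 ≤ b) (i : ι) :
    (#{A ∈ powersetCard b (univ : Finset ι) | i ∈ A}) * Fintype.card ι
      = b * #(powersetCard b (univ : Finset ι)) := by
  have hc := card_filter_powersetCard_subset {i} univ b (subset_univ _) (by simpa using hb)
  simp only [singleton_subset_iff, card_singleton, card_univ] at hc
  obtain ⟨m, hm⟩ := Nat.exists_eq_add_of_le' (Fintype.card_pos_iff.2 ⟨i⟩ : 1 ≤ Fintype.card ι)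
  obtain ⟨k, rfl⟩ := Nat.exists_eq_add_of_le' hb
  rw [hc, card_powersetCard, card_univ, hm]
  simp only [Nat.add_sub_cancel]
  linarith [Nat.add_one_mul_choose_eq m k]

lemma card_filter_mem_mem_powersetCard_mul {b : ℕ} {i j : ι} (hij : i ≠ j) :
    (#{A ∈ powersetCard b (univ : Finset ι) | i ∈ A ∧ j ∈ A}) *
        (Fintype.card ι * (Fintype.card ι - 1))
      = b * (b - 1) * #(powersetCard b (univ : Finset ι)) := by
  rcases lt_or_ge b 2 with hb | hb
  · have h0 : b * (b - 1) = 0 := by interval_cases b <;> rfl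
    rw [h0, zero_mul, Nat.mul_eq_zero]
    refine Or.inl (card_eq_zero.2 (filter_eq_empty_iff.2 fun A hA ⟨hi, hj⟩ => ?_))
    have h1 : #A ≤ 1 := by rw [(mem_powersetCard.1 hA).2]; omega
    exact hij (card_le_one.1 h1 i hi j hj)
  have hc := card_filter_powersetCard_subset {i, j} univ b (subset_univ _)
    (by rwa [card_pair hij])
  simp only [insert_subset_iff, singleton_subset_iff, card_pair hij, card_univ] at hc
  have hn : 2 ≤ Fintype.card ι := by
    simpa [card_pair hij] using card_le_univ ({i, j} : Finset ι)
  obtain ⟨m, hm⟩ := Nat.exists_eq_add_of_le' hn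
  obtain ⟨k, rfl⟩ := Nat.exists_eq_add_of_le' hb
  rw [hc, card_powersetCard, card_univ, hm]
  have h1 := Nat.add_one_mul_choose_eq m k
  have h2 := Nat.add_one_mul_choose_eq (m + 1) (k + 1)
  simp only [Nat.add_sub_cancel, show m + 2 - 1 = m + 1 by omega, show k + 2 - 1 = k + 1 by omega]
  calc m.choose k * ((m + 2) * (m + 1)) = (m + 1 + 1) * ((m + 1) * m.choose k) := by ring
    _ = ((m + 1 + 1) * (m + 1).choose (k + 1)) * (k + 1) := by rw [h1]; ring
    _ = _ := by rw [h2]; ring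

lemma sum_powersetCard_sum {M : Type*} [AddCommMonoid M] (b : ℕ) (w : ι → M) :
    ∑ A ∈ powersetCard b (univ : Finset ι), ∑ i ∈ A, w i
      = ∑ i, #{A ∈ powersetCard b (univ : Finset ι) | i ∈ A} • w i := by
  rw [sum_comm' (t' := univ) (s' := fun i => {A ∈ powersetCard b (univ : Finset ι) | i ∈ A})
    (by simp)]
  simp

variable {E : Type*} [NormedAddCommGroup E] [InnerProductSpace ℝ E]

lemma sum_powersetCard_sum_eq_zero {b : ℕ} (hb : 1 ≤ b) {w : ι → E} (hw : ∑ i, w i = 0) :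
    ∑ A ∈ powersetCard b (univ : Finset ι), ∑ i ∈ A, w i = 0 := by
  rcases isEmpty_or_nonempty ι with h | h
  · rw [sum_powersetCard_sum]
    simp
  have hn : (Fintype.card ι : ℝ) ≠ 0 := by exact_mod_cast Fintype.card_ne_zero
  refine (smul_eq_zero_iff_right hn).1 ?_
  rw [sum_powersetCard_sum, smul_sum]
  have (i : ι) : (Fintype.card ι : ℝ) • (#{A ∈ powersetCard b (univ : Finset ι) | i ∈ A} • w i)
      = ((b : ℝ) * #(powersetCard b (univ : Finset ι))) • w i := by
    rw [← Nat.cast_smul_eq_nsmul ℝ, smul_smul]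
    congr 1
    have := card_filter_mem_powersetCard_mul hb i
    rw [mul_comm]
    exact_mod_cast this
  simp only [this, ← smul_sum, hw, smul_zero]

/-- Second moment of the sum of a centred population over a uniform sample without replacement. -/
lemma sum_powersetCard_sq_norm_sum {b : ℕ} (hb : 1 ≤ b) (hn : 2 ≤ Fintype.card ι) {w : ι → E}
    (hw : ∑ i, w i = 0) :
    ∑ A ∈ powersetCard b (univ : Finset ι), ‖∑ i ∈ A, w i‖ ^ 2
      = #(powersetCard b (univ : Finset ι)) *
        (b * (Fintype.card ι - b) / (Fintype.card ι * (Fintype.card ι - 1)) * ∑ i, ‖w i‖ ^ 2) := by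
  set N := (#(powersetCard b (univ : Finset ι)) : ℝ) with hN
  set n := (Fintype.card ι : ℝ) with hn'
  have hn2 : (2 : ℝ) ≤ n := by rw [hn']; exact_mod_cast hn
  have hn0 : n ≠ 0 := by linarith
  have hn1 : n - 1 ≠ 0 := by linarith
  have hcount (i j : ι) : (#{A ∈ powersetCard b (univ : Finset ι) | i ∈ A ∧ j ∈ A} : ℝ)
      = b * (b - 1) * N / (n * (n - 1)) + if i = j then N * (b * (n - b) / (n * (n - 1))) else 0 := by
    split_ifs with hij
    · subst hij
      have := card_filter_mem_powersetCard_mul hb i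
      have h1 : (#{A ∈ powersetCard b (univ : Finset ι) | i ∈ A} : ℝ) * n = b * N := by
        rw [hn', hN]; exact_mod_cast this
      simp only [and_self]
      rw [eq_div_of_mul_eq hn0 h1]
      field_simp
      ring
    · have := congrArg (Nat.cast (R := ℝ)) (card_filter_mem_mem_powersetCard_mul (b := b) hij)
      push_cast [Nat.cast_sub hb, Nat.cast_sub (one_le_two.trans hn)] at this
      rw [add_zero, eq_div_iff (mul_ne_zero hn0 hn1)]
      exact this
  have hexp (A : Finset ι) : ‖∑ i ∈ A, w i‖ ^ 2
      = ∑ i, ∑ j, if i ∈ A ∧ j ∈ A then ⟪w i, w j⟫ else 0 := by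
    rw [← real_inner_self_eq_norm_sq, sum_inner]
    simp only [inner_sum, ite_and, sum_ite_irrel, sum_ite_mem, univ_inter, sum_const_zero]
  simp only [hexp]
  rw [sum_comm]
  have hswap (i : ι) : ∑ A ∈ powersetCard b (univ : Finset ι),
        ∑ j, (if i ∈ A ∧ j ∈ A then ⟪w i, w j⟫ else 0)
      = ∑ j, (#{A ∈ powersetCard b (univ : Finset ι) | i ∈ A ∧ j ∈ A} : ℝ) * ⟪w i, w j⟫ := by
    rw [sum_comm]
    simp [← sum_filter]
  simp only [hswap, hcount, add_mul, sum_add_distrib, ite_mul, zero_mul, sum_ite_eq, mem_univ,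
    if_true, ← mul_sum, ← inner_sum, hw, inner_zero_right, mul_zero, zero_add,
    real_inner_self_eq_norm_sq, mul_assoc]

end Sampling

section FiniteSum

variable {ι : Type*} [Fintype ι]
variable {E : Type*} [NormedAddCommGroup E] [InnerProductSpace ℝ E] [CompleteSpace E]

lemma mean_add_inner_le {f : ι → E → ℝ} {f' : ι → E → E}
    (hconv : ∀ i, ConvexOn ℝ Set.univ (f i)) (hgrad : ∀ i x, HasGradientAt (f i) (f' i x) x)
    {c : ℝ} (hc : 0 ≤ c) (x y : E) :
    c * ∑ i, f i x + ⟪c • ∑ i, f' i x, y - x⟫ ≤ c * ∑ i, f i y := by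
  rw [real_inner_smul_left, sum_inner, ← mul_add, ← sum_add_distrib]
  gcongr with i
  exact (hconv i).add_inner_le_of_hasGradientAt (hgrad i x) y

lemma mean_le_add_inner_add_sq {f : ι → E → ℝ} {f' : ι → E → E} {L : ℝ}
    (hgrad : ∀ i x, HasGradientAt (f i) (f' i x) x)
    (hlip : ∀ i x y, ‖f' i x - f' i y‖ ≤ L * ‖x - y‖) {c : ℝ} (hc : 0 ≤ c)
    (hcard : c * Fintype.card ι = 1) (x y : E) :
    c * ∑ i, f i y
      ≤ c * ∑ i, f i x + ⟪c • ∑ i, f' i x, y - x⟫ + L / 2 * ‖y - x‖ ^ 2 := by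
  have := sum_le_sum fun i (_ : i ∈ univ) =>
    le_add_inner_add_sq_of_lipschitz_gradient (hgrad i) (hlip i) x y
  rw [sum_add_distrib, sum_add_distrib, ← sum_inner, sum_const, card_univ, nsmul_eq_mul] at this
  have h2 := mul_le_mul_of_nonneg_left this hc
  rw [real_inner_smul_left]
  linear_combination h2 + (L / 2 * ‖y - x‖ ^ 2) * hcard

/-- At a minimizer `u` of the composite objective, the mean squared gradient deviation is
controlled by the objective gap. -/
lemma mean_sq_norm_gradient_sub_le {f : ι → E → ℝ} {f' : ι → E → E} {L : ℝ} (hL : 0 < L)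
    (hconv : ∀ i, ConvexOn ℝ Set.univ (f i)) (hgrad : ∀ i x, HasGradientAt (f i) (f' i x) x)
    (hlip : ∀ i x y, ‖f' i x - f' i y‖ ≤ L * ‖x - y‖) {c : ℝ} (hc : 0 ≤ c)
    (hcard : c * Fintype.card ι = 1) {R : E → ℝ} (hR : ConvexOn ℝ Set.univ R) {u : E}
    (hu : ∀ z, c * ∑ i, f i u + R u ≤ c * ∑ i, f i z + R z) (z : E) :
    c * ∑ i, ‖f' i z - f' i u‖ ^ 2
      ≤ 2 * L * ((c * ∑ i, f i z + R z) - (c * ∑ i, f i u + R u)) := by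
  have hopt := hR.inner_add_sub_nonneg_of_minimizer (φ := fun z => c * ∑ i, f i z)
    (mean_le_add_inner_add_sq hgrad hlip hc hcard u) hu z
  have := sum_le_sum fun i (_ : i ∈ univ) =>
    (hconv i).sq_norm_gradient_sub_le hL (hgrad i) (hlip i) z u
  rw [← mul_sum, sum_sub_distrib, sum_sub_distrib, ← sum_inner] at this
  have h2 := mul_le_mul_of_nonneg_left this hc
  rw [real_inner_smul_left] at hopt
  nlinarith [mul_nonneg hL.le hopt]

end FiniteSum

/-- One-step expected decrease for the proximal mini-batch step (inequality (22) in the paper).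
With `G(A) = ∇F(x) + (1/b) ∑_{i∈A} (∇f_i(y) − ∇f_i(x))` and
`y⁺(A) = prox_{hR}(y − h·G(A))` for a uniformly random `b`-element subset `A`:
`E[‖y⁺(A) − x*‖²] + 2h·E[P(y⁺(A)) − P(x*)]
  ≤ ‖y − x*‖² + 8·L·h²·α(b)·(P(y) − P(x*) + P(x) − P(x*))`. -/
theorem minibatch_prox_one_step (d n : ℕ) (hd : 1 ≤ d) (hn : 2 ≤ n)
    (f : Fin n → EuclideanSpace ℝ (Fin d) → ℝ)
    (f' : Fin n → EuclideanSpace ℝ (Fin d) → EuclideanSpace ℝ (Fin d))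
    (L : ℝ) (hL : 0 < L)
    (hconv : ∀ i, ConvexOn ℝ Set.univ (f i))
    (hgrad : ∀ i x, HasGradientAt (f i) (f' i x) x)
    (hlip : ∀ i x y, ‖f' i x - f' i y‖ ≤ L * ‖x - y‖)
    (F : EuclideanSpace ℝ (Fin d) → ℝ) (hF : ∀ x, F x = (n : ℝ)⁻¹ * ∑ i, f i x)
    (R : EuclideanSpace ℝ (Fin d) → ℝ) (hRconv : ConvexOn ℝ Set.univ R)
    (hRcont : Continuous R)
    (P : EuclideanSpace ℝ (Fin d) → ℝ) (hP : ∀ x, P x = F x + R x)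
    (μ : ℝ) (hμ : 0 < μ)
    (hstrong : ConvexOn ℝ Set.univ (fun x => P x - μ / 2 * ‖x‖ ^ 2))
    (xstar : EuclideanSpace ℝ (Fin d)) (hxstar : ∀ x, P xstar ≤ P x)
    (x y : EuclideanSpace ℝ (Fin d))
    (b : ℕ) (hb1 : 1 ≤ b) (hbn : b ≤ n)
    (h : ℝ) (hh0 : 0 < h) (hhL : h ≤ 1 / L)
    (G : Finset (Fin n) → EuclideanSpace ℝ (Fin d))
    (hG : ∀ A, G A = ((n : ℝ)⁻¹ • ∑ i, f' i x)
        + (b : ℝ)⁻¹ • ∑ i ∈ A, (f' i y - f' i x))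
    (yplus : Finset (Fin n) → EuclideanSpace ℝ (Fin d))
    (hyplus : ∀ A z, (1 / 2) * ‖yplus A - (y - h • G A)‖ ^ 2 + h * R (yplus A)
        ≤ (1 / 2) * ‖z - (y - h • G A)‖ ^ 2 + h * R z) :
    (((Finset.powersetCard b (Finset.univ : Finset (Fin n))).card : ℝ))⁻¹ *
        (∑ A ∈ Finset.powersetCard b (Finset.univ : Finset (Fin n)), ‖yplus A - xstar‖ ^ 2)
      + 2 * h * ((((Finset.powersetCard b (Finset.univ : Finset (Fin n))).card : ℝ))⁻¹ *
          ∑ A ∈ Finset.powersetCard b (Finset.univ : Finset (Fin n)), (P (yplus A) - P xstar))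
      ≤ ‖y - xstar‖ ^ 2
        + 8 * L * h ^ 2 * (((n : ℝ) - (b : ℝ)) / ((b : ℝ) * ((n : ℝ) - 1))) *
            ((P y - P xstar) + (P x - P xstar)) := by
  obtain rfl : F = fun z => (n : ℝ)⁻¹ * ∑ i, f i z := funext hF
  obtain rfl : P = fun z => (n : ℝ)⁻¹ * ∑ i, f i z + R z := funext hP
  have hn2 : (2 : ℝ) ≤ n := by exact_mod_cast hn
  have hn0 : (n : ℝ) ≠ 0 := by linarith
  have hn1 : (0 : ℝ) < n - 1 := by linarith
  have hb0 : (0 : ℝ) < b := by exact_mod_cast hb1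
  have hbn' : (b : ℝ) ≤ n := by exact_mod_cast hbn
  have hc : (0 : ℝ) ≤ (n : ℝ)⁻¹ := by positivity
  have hcard : (n : ℝ)⁻¹ * Fintype.card (Fin n) = 1 := by
    rw [Fintype.card_fin]; exact inv_mul_cancel₀ hn0
  have hhL' : h * L ≤ 1 := (le_div_iff₀ hL).1 hhL
  set g : EuclideanSpace ℝ (Fin d) → EuclideanSpace ℝ (Fin d) :=
    fun z => (n : ℝ)⁻¹ • ∑ i, f' i z with hg
  set S := Finset.powersetCard b (Finset.univ : Finset (Fin n)) with hS
  have hN : (0 : ℝ) < S.card := by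
    rw [hS, card_powersetCard, card_univ, Fintype.card_fin]
    exact_mod_cast Nat.choose_pos hbn
  set w : Fin n → EuclideanSpace ℝ (Fin d) :=
    fun i => (f' i y - f' i x) - (g y - g x) with hw
  have hmean : ∑ i, (f' i y - f' i x) = (Fintype.card (Fin n) : ℝ) • (g y - g x) := by
    rw [Fintype.card_fin, sum_sub_distrib, hg, smul_sub, smul_inv_smul₀ hn0, smul_inv_smul₀ hn0]
  have hw0 : ∑ i, w i = 0 := by
    rw [hw, sum_sub_distrib, hmean, sum_const, card_univ, ← Nat.cast_smul_eq_nsmul ℝ, sub_self]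
  set δ : Finset (Fin n) → EuclideanSpace ℝ (Fin d) := fun A => G A - g y with hδ
  have hδw : ∀ A ∈ S, δ A = (b : ℝ)⁻¹ • ∑ i ∈ A, w i := by
    intro A hA
    have hA' : #A = b := (mem_powersetCard.1 hA).2
    simp only [hδ, hG, hw]
    rw [sum_sub_distrib (fun i => f' i y - f' i x), sum_const, hA',
      ← Nat.cast_smul_eq_nsmul ℝ, smul_sub,
      inv_smul_smul₀ hb0.ne']
    abel
  have hδ0 : ∑ A ∈ S, δ A = 0 := by
    rw [sum_congr rfl hδw, ← smul_sum, hS, sum_powersetCard_sum_eq_zero hb1 hw0, smul_zero]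
  have hvar : ∑ A ∈ S, ‖δ A‖ ^ 2
      = S.card * (((n : ℝ) - b) / (b * (n - 1)) * ((n : ℝ)⁻¹ * ∑ i, ‖w i‖ ^ 2)) := by
    have h1 : ∑ A ∈ S, ‖δ A‖ ^ 2 = ((b : ℝ)⁻¹) ^ 2 * ∑ A ∈ S, ‖∑ i ∈ A, w i‖ ^ 2 := by
      rw [mul_sum]
      refine sum_congr rfl fun A hA => ?_
      rw [hδw A hA, norm_smul, mul_pow, Real.norm_eq_abs, sq_abs]
    rw [h1, hS, sum_powersetCard_sq_norm_sum hb1 (by simpa using hn) hw0, Fintype.card_fin]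
    have := hn1.ne'
    field_simp
  have hdev (z : EuclideanSpace ℝ (Fin d)) :=
    mean_sq_norm_gradient_sub_le hL hconv hgrad hlip hc hcard hRconv hxstar z
  have hwle : (n : ℝ)⁻¹ * ∑ i, ‖w i‖ ^ 2 ≤ (n : ℝ)⁻¹ *
      ∑ i, (2 * ‖f' i y - f' i xstar‖ ^ 2 + 2 * ‖f' i x - f' i xstar‖ ^ 2) := by
    refine mul_le_mul_of_nonneg_left ((sum_sq_norm_sub_mean_le hmean).trans
      (sum_le_sum fun i _ => ?_)) hc
    rw [← sub_sub_sub_cancel_right (f' i y) (f' i x) (f' i xstar)]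
    linarith [parallelogram_law_with_norm ℝ (f' i y - f' i xstar) (f' i x - f' i xstar),
      mul_self_nonneg ‖(f' i y - f' i xstar) + (f' i x - f' i xstar)‖]
  rw [sum_add_distrib, ← mul_sum, ← mul_sum] at hwle
  have hstep : ∀ A ∈ S, _ := fun A _ =>
    hRconv.prox_grad_step (F := fun z => (n : ℝ)⁻¹ * ∑ i, f i z) (δ := δ A) (p := yplus A)
      (g := g y) (y := y) (u := xstar) hh0 hhL' (by simpa [hδ] using hyplus A)
      (mean_add_inner_le hconv hgrad hc y xstar)
      (mean_le_add_inner_add_sq hgrad hlip hc hcard y (yplus A))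
  have hsum := sum_le_sum hstep
  simp only [sum_add_distrib, ← mul_sum, sum_const, nsmul_eq_mul] at hsum
  have hlin : ∑ A ∈ S, (⟪δ A, xstar⟫ - ⟪δ A, yplus A⟫) = -∑ A ∈ S, ⟪δ A, yplus A⟫ := by
    rw [sum_sub_distrib, ← sum_inner, hδ0, inner_zero_left, zero_sub]
  rw [hlin] at hsum
  have hcorr := sum_neg_inner_le_of_pairwise S (δ := δ) (p := yplus) (h := h) hδ0
    fun A _ B _ => by
      simpa [hδ] using hRconv.inner_sub_le_of_prox_of_prox hh0 (hyplus A) (hyplus B)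
  rw [hvar] at hcorr
  have hα : 0 ≤ ((n : ℝ) - b) / (b * (n - 1)) :=
    div_nonneg (sub_nonneg.2 hbn') (mul_nonneg hb0.le hn1.le)
  set α := ((n : ℝ) - b) / (b * (n - 1))
  have hfinal := mul_le_mul_of_nonneg_left (hwle.trans (b := (n : ℝ)⁻¹ *
    (2 * ∑ i, ‖f' i y - f' i xstar‖ ^ 2 + 2 * ∑ i, ‖f' i x - f' i xstar‖ ^ 2))
    (by linarith [hdev x, hdev y] : _ ≤ 4 * L *
      ((((n : ℝ)⁻¹ * ∑ i, f i y + R y) - ((n : ℝ)⁻¹ * ∑ i, f i xstar + R xstar)) +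
        (((n : ℝ)⁻¹ * ∑ i, f i x + R x) - ((n : ℝ)⁻¹ * ∑ i, f i xstar + R xstar))))) hα
  have hscaled := mul_le_mul_of_nonneg_left hfinal
    (mul_nonneg hN.le (mul_nonneg two_pos.le (sq_nonneg h)))
  have hcorr2 := mul_le_mul_of_nonneg_left hcorr (mul_nonneg two_pos.le hh0.le)
  rw [mul_left_comm (2 * h), ← mul_add, inv_mul_le_iff₀ hN]
  simp only [sum_sub_distrib, sum_const, nsmul_eq_mul] at hsum ⊢
  linarith
end
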